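/- arXiv:1206.0200 — 3 statements merged into one kernel-verified Lean document; each statement's English description precedes it below -/
import Mathlib

section
/- Let A be an associative ring equipped with a star operation (an additive involution * satisfying (xy)* = y* x* and x** = x) such that for every y in A the element y y* lies in the center of A. Fix x, a₀, a₁, …, a_k in A and define the monomial p₀ = a₀ and p_i = p_{i-1} x a_i for 1 ≤ i ≤ k. Then p_k (p_k)* = (x x*)^k (a₀ a₀*)(a₁ a₁*) ⋯ (a_k a_k*). -/
/-- If every `y * star y` is central, then `y ↦ y * star y` is multiplicative. -/
theorem mul_mul_star_mul_of_central {A : Type*} [Semigroup A] [StarMul A]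
    (hcentral : ∀ y z : A, (y * star y) * z = z * (y * star y)) (u v : A) :
    (u * v) * star (u * v) = (u * star u) * (v * star v) := by
  calc (u * v) * star (u * v) = u * ((v * star v) * star u) := by
        simp only [star_mul, mul_assoc]
    _ = (u * star u) * (v * star v) := by rw [hcentral v, mul_assoc]

/-- Let `A` be an associative star ring in which `y * y*` is always central.
For the monomial `p₀ = a₀`, `pᵢ = p_{i-1} x aᵢ`, we have
`p_k (p_k)* = (x x*)^k (a₀ a₀*)(a₁ a₁*) ⋯ (a_k a_k*)`. -/
theorem monomial_mul_star_eq {A : Type*} [Ring A] [StarRing A]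
    (hcentral : ∀ y z : A, (y * star y) * z = z * (y * star y))
    (x : A) (k : ℕ) (a : ℕ → A) (p : ℕ → A)
    (hp0 : p 0 = a 0)
    (hp : ∀ i, 1 ≤ i → i ≤ k → p i = p (i - 1) * x * a i) :
    p k * star (p k) =
      (x * star x) ^ k *
        ((List.range (k + 1)).map (fun i => a i * star (a i))).prod := by
  induction k with
  | zero => simp [hp0]
  | succ k ih =>
    have ih' := ih fun i h₁ h₂ => hp i h₁ (h₂.trans k.le_succ)
    rw [hp (k + 1) k.succ_pos le_rfl, Nat.add_sub_cancel,
      mul_mul_star_mul_of_central hcentral, mul_mul_star_mul_of_central hcentral, ih',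
      List.range_succ (n := k + 1), List.map_append, List.prod_append, List.map_singleton,
      List.prod_singleton, mul_assoc ((x * star x) ^ k), ← hcentral x, pow_succ]
    simp only [mul_assoc]
end

section
/- Let K be a field and let A be a nontrivial associative unital K-algebra equipped with a star operation (an additive involution * satisfying (xy)* = y* x* and x** = x). Assume that for every x in A, x x* = x* x, and that x x* lies in the image of the structure map K → A. Then for every a ∈ A: a a* = 0 if and only if a = 0 or a is a zero divisor (there exists b ≠ 0 with a b = 0). -/
/-- Let `A` be a nontrivial associative unital algebra over a field `K` with a star
operation such that `x x* = x* x` and `x x*` is a scalar for every `x`. Then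
`a a* = 0` iff `a = 0` or `a` is a zero divisor. -/
theorem mul_star_eq_zero_iff {K : Type*} [Field K]
    {A : Type*} [Ring A] [Nontrivial A] [Algebra K A] [StarRing A]
    (hcomm : ∀ x : A, x * star x = star x * x)
    (hscalar : ∀ x : A, x * star x ∈ Set.range (algebraMap K A))
    (a : A) :
    a * star a = 0 ↔ a = 0 ∨ ∃ b : A, b ≠ 0 ∧ a * b = 0 := by
  constructor
  · intro h
    exact or_iff_not_imp_left.2 fun ha => ⟨star a, star_ne_zero.2 ha, h⟩
  · rintro (rfl | ⟨b, hb, hab⟩)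
    · exact zero_mul _
    · obtain ⟨c, hc⟩ := hscalar a
      have hcb : c • b = 0 := by
        rw [Algebra.smul_def, hc, hcomm, mul_assoc, hab, mul_zero]
      rw [← hc, (smul_eq_zero.1 hcb).resolve_right hb, map_zero]
end

section
/- Let A be an associative ring equipped with a star operation (an additive involution * satisfying (xy)* = y* x* and x** = x) such that for every x in A the element x x* lies in the center of A. If a ∈ A satisfies a a* = 0, then for every b ∈ A both (ab)(ab)* = 0 and (ba)(ba)* = 0; that is, the left principal ideal A a and the right principal ideal a A are contained in the set of zeros A₀ = {x ∈ A : x x* = 0}. -/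
/-- In an associative star ring in which `x * x*` is always central, if `a a* = 0`
then every element of the principal ideals `aA` and `Aa` lies in the set of zeros
`A₀ = {x : x x* = 0}`. -/
theorem principal_ideal_subset_zeros {A : Type*} [Ring A] [StarRing A]
    (hcentral : ∀ x y : A, (x * star x) * y = y * (x * star x))
    (a : A) (ha : a * star a = 0) :
    ∀ b : A, (a * b) * star (a * b) = 0 ∧ (b * a) * star (b * a) = 0 := by
  intro b
  constructor
  · calc (a * b) * star (a * b) = a * (b * star b) * star a := by
          simp only [star_mul, mul_assoc]
      _ = (b * star b) * (a * star a) := by rw [← hcentral b a, mul_assoc]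
      _ = 0 := by rw [ha, mul_zero]
  · calc (b * a) * star (b * a) = b * (a * star a) * star b := by
          simp only [star_mul, mul_assoc]
      _ = 0 := by rw [ha, mul_zero, zero_mul]
end
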